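/- The convex conjugate of F equals G: for every θ₂ ∈ ℝ, F*(θ₂) := sup_{b∈ℝ} (θ₂·b − F(b)) = G(θ₂). In particular, the function G is a closed (lower semicontinuous) convex function. -/

import Mathlib

open MeasureTheory Filter Set Topology
open scoped ENNReal

noncomputable section

variable {Ω : Type*} [MeasurableSpace Ω]

/-- The positive part of an extended real number, as a member of `ℝ≥0∞`. -/
def ePos (x : EReal) : ℝ≥0∞ := if x = ⊤ then ⊤ else ENNReal.ofReal x.toReal

/-- The (signed) integral of an extended-real-valued function: the integral of its
positive part minus the integral of its negative part. -/
def eInt (μ : Measure Ω) (f : Ω → EReal) : EReal :=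
  ((∫⁻ r, ePos (f r) ∂μ : ℝ≥0∞) : EReal) - ((∫⁻ r, ePos (-(f r)) ∂μ : ℝ≥0∞) : EReal)

/-- `p` is a probability density with respect to `μ`. -/
def IsDensity (μ : Measure Ω) (p : Ω → ℝ) : Prop :=
  Measurable p ∧ (∀ r, 0 ≤ p r) ∧ ∫⁻ r, ENNReal.ofReal (p r) ∂μ = 1

/-- `∫ p dμ` for a nonnegative function `p`. -/
def pInt (μ : Measure Ω) (p : Ω → ℝ) : ℝ≥0∞ := ∫⁻ r, ENNReal.ofReal (p r) ∂μ

/-- The convex integral functional `H(p) = ∫ β(r, p(r)) μ(dr)`. -/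
def Hfun (μ : Measure Ω) (β : Ω → ℝ → EReal) (p : Ω → ℝ) : EReal :=
  eInt μ (fun r => β r (p r))

/-- The expected payoff `∫ X p dμ`, as an extended real number. -/
def xInt (μ : Measure Ω) (X p : Ω → ℝ) : EReal :=
  eInt μ (fun r => ((X r * p r : ℝ) : EReal))

/-- The value function `F(b) = inf { H(p) : p density, ∫ X p dμ = b }`. -/
def Ffun (μ : Measure Ω) (β : Ω → ℝ → EReal) (X : Ω → ℝ) (b : ℝ) : EReal :=
  ⨅ p : {p : Ω → ℝ // IsDensity μ p ∧ xInt μ X p = (b : EReal)}, Hfun μ β p.1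

/-- The essential infimum `m` of `X`, as an extended real number. -/
def essInfX (μ : Measure Ω) (X : Ω → ℝ) : EReal := essInf (fun r => (X r : EReal)) μ

/-- The essential supremum `M` of `X`, as an extended real number. -/
def essSupX (μ : Measure Ω) (X : Ω → ℝ) : EReal := essSup (fun r => (X r : EReal)) μ

/-- `k_max = lim_{b ↓ m} F(b)`; since `F` is nonincreasing on `(m, b₀)`, this limit
equals the supremum of `F` over `(m, b₀)`. -/
def kmax (μ : Measure Ω) (β : Ω → ℝ → EReal) (X : Ω → ℝ) (b₀ : ℝ) : EReal :=
  ⨆ b : {b : ℝ // essInfX μ X < (b : EReal) ∧ b < b₀}, Ffun μ β X b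

/-- `V(k) = inf { ∫ X p dμ : p density, H(p) ≤ k }`. -/
def Vfun (μ : Measure Ω) (β : Ω → ℝ → EReal) (X : Ω → ℝ) (k : ℝ) : EReal :=
  ⨅ p : {p : Ω → ℝ // IsDensity μ p ∧ Hfun μ β p ≤ (k : EReal)}, xInt μ X p.1

/-- `W(λ) = inf { ∫ X p dμ + λ H(p) : p density }`. -/
def Wfun (μ : Measure Ω) (β : Ω → ℝ → EReal) (X : Ω → ℝ) (lam : ℝ) : EReal :=
  ⨅ p : {p : Ω → ℝ // IsDensity μ p}, (xInt μ X p.1 + (lam : EReal) * Hfun μ β p.1)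

/-- The convex conjugate `β*(r, τ) = sup_s (sτ − β(r,s))` of `β` in its second variable. -/
def conjβ (β : Ω → ℝ → EReal) (r : Ω) (τ : ℝ) : EReal :=
  ⨆ s : ℝ, (((s * τ : ℝ) : EReal) - β r s)

/-- `K(θ₁, θ₂) = ∫ β*(r, θ₁ + θ₂ X(r)) μ(dr)`. -/
def Kfun (μ : Measure Ω) (β : Ω → ℝ → EReal) (X : Ω → ℝ) (θ₁ θ₂ : ℝ) : EReal :=
  eInt μ (fun r => conjβ β r (θ₁ + θ₂ * X r))

/-- `dom K = {(θ₁, θ₂) : K(θ₁,θ₂) < +∞}`. -/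
def domK (μ : Measure Ω) (β : Ω → ℝ → EReal) (X : Ω → ℝ) : Set (ℝ × ℝ) :=
  {θ : ℝ × ℝ | Kfun μ β X θ.1 θ.2 < ⊤}

/-- `β'(r, +∞) = lim_{s ↑ ∞} β'(r,s)`; by monotonicity of the derivative of a convex
function this equals the supremum of `β'(r, ·)` over `(0, ∞)`. -/
def derivTop (β' : Ω → ℝ → ℝ) (r : Ω) : EReal := ⨆ s : {s : ℝ // 0 < s}, (β' r s.1 : EReal)

/-- `β'(r, 0) = lim_{s ↓ 0} β'(r,s)`, the infimum of `β'(r, ·)` over `(0, ∞)`. -/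
def derivZero (β' : Ω → ℝ → ℝ) (r : Ω) : EReal := ⨅ s : {s : ℝ // 0 < s}, (β' r s.1 : EReal)

/-- The parameter set `Θ`. -/
def ThetaSet (μ : Measure Ω) (β : Ω → ℝ → EReal) (β' : Ω → ℝ → ℝ) (X : Ω → ℝ) :
    Set (ℝ × ℝ) :=
  {θ ∈ domK μ β X | ∀ᵐ r ∂μ, ((θ.1 + θ.2 * X r : ℝ) : EReal) < derivTop β' r}

/-- The generalised exponential family member `p_{θ₁,θ₂}(r) = (β*)'(r, θ₁ + θ₂ X(r))`,
where `ψ` denotes the derivative `(β*)'` of the conjugate in its second variable. -/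
def pFam (ψ : Ω → ℝ → ℝ) (X : Ω → ℝ) (θ₁ θ₂ : ℝ) : Ω → ℝ :=
  fun r => ψ r (θ₁ + θ₂ * X r)

/-- `G(θ₂) = inf_{θ₁} [K(θ₁,θ₂) − θ₁]`. -/
def Gfun (μ : Measure Ω) (β : Ω → ℝ → EReal) (X : Ω → ℝ) (θ₂ : ℝ) : EReal :=
  ⨅ θ₁ : ℝ, (Kfun μ β X θ₁ θ₂ - (θ₁ : EReal))

/-- `Θ₂ = dom G`, the projection of `dom K` to the `θ₂`-axis. -/
def Theta2 (μ : Measure Ω) (β : Ω → ℝ → EReal) (X : Ω → ℝ) : Set ℝ :=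
  {θ₂ : ℝ | Gfun μ β X θ₂ < ⊤}

/-- The Bregman integrand `Δ_β(r, s, t)`; for `t = 0` it is defined as the limit `t ↓ 0`
(with `β'(r,0) = lim_{t↓0} β'(r,t)`), and if `β(r,0) = +∞` then `Δ_β(r,0,0) = 0` and
`Δ_β(r,s,0) = +∞` for `s > 0`. -/
def bregmanInt (β : Ω → ℝ → EReal) (β' : Ω → ℝ → ℝ) (r : Ω) (s t : ℝ) : EReal :=
  if 0 < t then β r s - β r t - ((β' r t : EReal) * ((s - t : ℝ) : EReal))
  else if β r 0 = ⊤ then (if s = 0 then 0 else ⊤)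
  else β r s - β r 0 - derivZero β' r * ((s : ℝ) : EReal)

/-- The (generalised) Bregman distance `B(p, q)`. -/
def Bdist (μ : Measure Ω) (β : Ω → ℝ → EReal) (β' : Ω → ℝ → ℝ) (p q : Ω → ℝ) : EReal :=
  eInt μ (fun r => bregmanInt β β' r (p r) (q r))

/-- The standing assumptions of the framework: `μ` is σ-finite; `β` is a normal convex
integrand (measurable in `r`; equal to `+∞` for `s < 0`; finite, strictly convex and
differentiable with derivative `β'` on `(0,∞)`; right-continuous at `0`); `p₀` is a
density with finite expected payoff `b₀` satisfying `m < b₀ < M`; `H(p₀) = 0 ≤ H(p)`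
for every density `p`; and `k_max > 0`. -/
structure Standing (μ : Measure Ω) (β : Ω → ℝ → EReal) (β' : Ω → ℝ → ℝ)
    (X : Ω → ℝ) (p₀ : Ω → ℝ) (b₀ : ℝ) : Prop where
  sigma : SigmaFinite μ
  betaMeas : ∀ s : ℝ, Measurable (fun r => β r s)
  Xmeas : Measurable X
  betaNeg : ∀ r : Ω, ∀ s : ℝ, s < 0 → β r s = ⊤
  betaNeBot : ∀ r s, β r s ≠ ⊥
  betaFin : ∀ r : Ω, ∀ s : ℝ, 0 < s → β r s ≠ ⊤
  betaZero : ∀ r, Tendsto (fun s => β r s) (𝓝[>] (0:ℝ)) (𝓝 (β r 0))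
  betaConv : ∀ r, StrictConvexOn ℝ (Ioi (0:ℝ)) (fun s => (β r s).toReal)
  betaDeriv : ∀ r : Ω, ∀ s ∈ Ioi (0:ℝ), HasDerivAt (fun t => (β r t).toReal) (β' r s) s
  dens₀ : IsDensity μ p₀
  payoff₀ : xInt μ X p₀ = (b₀ : EReal)
  mlt : essInfX μ X < (b₀ : EReal)
  ltM : (b₀ : EReal) < essSupX μ X
  H₀ : Hfun μ β p₀ = 0
  Hnonneg : ∀ p, IsDensity μ p → 0 ≤ Hfun μ β p
  kmaxPos : 0 < kmax μ β X b₀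

/-- The hypothesis that `ψ = (β*)'`: at every point `τ < β'(r,+∞)`, where the conjugate
`β*(r,·)` is finite and differentiable, `ψ r τ` is its derivative. -/
def IsConjDeriv (β : Ω → ℝ → EReal) (β' : Ω → ℝ → ℝ) (ψ : Ω → ℝ → ℝ) : Prop :=
  ∀ r : Ω, ∀ τ : ℝ, ((τ : ℝ) : EReal) < derivTop β' r →
    HasDerivAt (fun t => (conjβ β r t).toReal) (ψ r τ) τ

/-- `(θ₁, θ₂)` with `θ₂ < 0` attains the double maximum
`max_{θ₂<0} max_{θ₁} (k + K(θ₁,θ₂) − θ₁)/θ₂` (whose value is `V(k)`); such a pair is a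
parameter pair of the worst case localiser `q̂_k = p_{θ₁,θ₂}`. -/
def IsWCLParam (μ : Measure Ω) (β : Ω → ℝ → EReal) (X : Ω → ℝ) (k : ℝ) (θ₁ θ₂ : ℝ) : Prop :=
  θ₂ < 0 ∧ ∀ θ₁' θ₂' : ℝ, θ₂' < 0 →
    ((k : EReal) + Kfun μ β X θ₁' θ₂' - (θ₁' : EReal)) / ((θ₂' : ℝ) : EReal) ≤
      ((k : EReal) + Kfun μ β X θ₁ θ₂ - (θ₁ : EReal)) / ((θ₂ : ℝ) : EReal)

/-- `p` is an (ε-γ)-almost worst case density for threshold `k`. -/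
def AWCD (μ : Measure Ω) (β : Ω → ℝ → EReal) (X : Ω → ℝ) (k ε γ : ℝ) (p : Ω → ℝ) : Prop :=
  IsDensity μ p ∧ Hfun μ β p ≤ ((k + γ : ℝ) : EReal) ∧
    xInt μ X p ≤ Vfun μ β X k + (ε : EReal)

/-- Convergence locally in measure. -/
def TendstoLocallyInMeasure (μ : Measure Ω) (p : ℕ → Ω → ℝ) (q : Ω → ℝ) : Prop :=
  ∀ C : Set Ω, MeasurableSet C → μ C < ⊤ → ∀ ε : ℝ, 0 < ε →
    Tendsto (fun n => μ {r ∈ C | ε < |p n r - q r|}) atTop (𝓝 0)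

end

section Integrals

variable {Ω : Type*} [MeasurableSpace Ω] {μ : Measure Ω}

lemma eInt_mono {f g : Ω → EReal} (h : ∀ r, f r ≤ g r) : eInt μ f ≤ eInt μ g := by
  refine EReal.sub_le_sub ?_ ?_ <;> refine EReal.coe_ennreal_le_coe_ennreal_iff.2
    (lintegral_mono fun r => EReal.toENNReal_le_toENNReal ?_)
  · exact h r
  · exact EReal.neg_le_neg_iff.2 (h r)

lemma eInt_congr_ae {f g : Ω → EReal} (h : f =ᵐ[μ] g) : eInt μ f = eInt μ g := by
  unfold eInt
  congr 2
  · exact lintegral_congr_ae (h.fun_comp ePos)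
  · exact lintegral_congr_ae (h.fun_comp fun x => ePos (-x))

lemma eInt_coe {f : Ω → ℝ} (hf : Integrable f μ) :
    eInt μ (fun r => (f r : EReal)) = ((∫ r, f r ∂μ : ℝ) : EReal) := by
  have h1 : ∫⁻ r, ENNReal.ofReal (f r) ∂μ ≠ ⊤ := hf.lintegral_lt_top.ne
  have h2 : ∫⁻ r, ENNReal.ofReal (-f r) ∂μ ≠ ⊤ := hf.neg.lintegral_lt_top.ne
  rw [integral_eq_lintegral_pos_part_sub_lintegral_neg_part hf, EReal.coe_sub,
    EReal.coe_ennreal_toReal h1, EReal.coe_ennreal_toReal h2]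
  rfl

lemma lintegral_neg_ne_top_of_eInt_ne_bot {f : Ω → EReal} (h : eInt μ f ≠ ⊥) :
    ∫⁻ r, ePos (-f r) ∂μ ≠ ⊤ := by
  intro h'
  apply h
  simp [eInt, h', sub_eq_add_neg]

lemma lintegral_pos_ne_top_of_eInt {f : Ω → EReal} (h : eInt μ f ≠ ⊥) (h' : eInt μ f ≠ ⊤) :
    ∫⁻ r, ePos (f r) ∂μ ≠ ⊤ := by
  intro h1
  have h2 := lintegral_neg_ne_top_of_eInt_ne_bot h
  apply h'
  unfold eInt
  rw [h1]
  lift ∫⁻ r, ePos (-f r) ∂μ to NNReal using h2 with x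
  exact EReal.top_sub_coe x

lemma integrable_of_lintegral_ofReal_ne_top {f : Ω → ℝ} (hf : Measurable f)
    (h : ∫⁻ r, ENNReal.ofReal (f r) ∂μ ≠ ⊤) (h' : ∫⁻ r, ENNReal.ofReal (-f r) ∂μ ≠ ⊤) :
    Integrable f μ := by
  refine ⟨hf.aestronglyMeasurable, ?_⟩
  refine lt_of_le_of_lt (lintegral_mono (g := fun r => ENNReal.ofReal (f r) +
    ENNReal.ofReal (-f r)) fun r => ?_) ?_
  · rcases le_total 0 (f r) with h0 | h0
    · simp [Real.enorm_of_nonneg h0]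
    · rw [← enorm_neg, Real.enorm_of_nonneg (neg_nonneg.2 h0)]
      exact le_add_self
  · rw [lintegral_add_left hf.ennreal_ofReal]
    exact ENNReal.add_lt_top.2 ⟨h.lt_top, h'.lt_top⟩

lemma integrable_of_eInt {f : Ω → ℝ} (hf : Measurable f)
    (h : eInt μ (fun r => (f r : EReal)) ≠ ⊥) (h' : eInt μ (fun r => (f r : EReal)) ≠ ⊤) :
    Integrable f μ :=
  integrable_of_lintegral_ofReal_ne_top hf (lintegral_pos_ne_top_of_eInt h h')
    (lintegral_neg_ne_top_of_eInt_ne_bot h)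

/-- Monotone convergence for the extended signed integral. -/
lemma eInt_iSup_le {f : ℕ → Ω → ℝ} (hf : ∀ n, Integrable (f n) μ)
    (hmono : ∀ r, Monotone fun n => f n r) {C : ℝ} (hC : ∀ n, ∫ r, f n r ∂μ ≤ C) :
    eInt μ (fun r => ⨆ n, (f n r : EReal)) ≤ C := by
  have hlim : ∀ r, Tendsto (fun n => (f n r : EReal)) atTop (𝓝 (⨆ n, (f n r : EReal))) :=
    fun r => tendsto_atTop_iSup fun m n hmn => EReal.coe_le_coe_iff.2 (hmono r hmn)
  have hmeas : ∀ n, AEMeasurable (fun r => ePos (f n r)) μ := fun n =>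
    (hf n).aestronglyMeasurable.aemeasurable.ennreal_ofReal
  have hmeas' : ∀ n, AEMeasurable (fun r => ePos (-(f n r : EReal))) μ := fun n =>
    (hf n).aestronglyMeasurable.aemeasurable.neg.ennreal_ofReal
  have hP := lintegral_tendsto_of_tendsto_of_monotone hmeas
    (ae_of_all _ fun r m n hmn => EReal.toENNReal_le_toENNReal
      (EReal.coe_le_coe_iff.2 (hmono r hmn)))
    (ae_of_all _ fun r => (EReal.continuous_toENNReal.tendsto _).comp (hlim r))
  have hfin : ∫⁻ r, ePos (-(f 0 r : EReal)) ∂μ ≠ ⊤ := (hf 0).neg.lintegral_lt_top.ne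
  have hN := lintegral_tendsto_of_tendsto_of_antitone hmeas'
    (ae_of_all _ fun r m n hmn => EReal.toENNReal_le_toENNReal
      (EReal.neg_le_neg_iff.2 (EReal.coe_le_coe_iff.2 (hmono r hmn)))) hfin
    (ae_of_all _ fun r => (EReal.continuous_toENNReal.tendsto _).comp
      ((continuous_neg.tendsto _).comp (hlim r)))
  have hNfin : ∫⁻ r, ePos (-(⨆ n, (f n r : EReal))) ∂μ ≠ ⊤ := by
    refine ne_top_of_le_ne_top hfin (lintegral_mono fun r => EReal.toENNReal_le_toENNReal ?_)
    exact EReal.neg_le_neg_iff.2 (le_iSup (fun n => (f n r : EReal)) 0)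
  have hP' := (continuous_coe_ennreal_ereal.tendsto _).comp hP
  have hN' := (continuous_neg.tendsto _).comp ((continuous_coe_ennreal_ereal.tendsto _).comp hN)
  have hsum := (EReal.continuousAt_add (p := (_, _)) (Or.inr ?_) (Or.inl ?_)).tendsto.comp
    (hP'.prodMk_nhds hN')
  · refine le_of_tendsto hsum (Eventually.of_forall fun n => ?_)
    have := eInt_coe (hf n)
    rw [eInt, sub_eq_add_neg] at this
    exact this.le.trans (EReal.coe_le_coe_iff.2 (hC n))
  · rw [ne_eq, EReal.neg_eq_bot_iff, EReal.coe_ennreal_eq_top_iff]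
    exact hNfin
  · exact EReal.coe_ennreal_ne_bot _

end Integrals

/-- One-dimensional Lagrange multiplier lemma. -/
lemma exists_multiplier (D : Set (ℝ × ℝ)) (σ : ℝ)
    (hzero : ∀ d ∈ D, d.1 = 0 → d.2 ≤ σ)
    (hcross : ∀ d ∈ D, ∀ e ∈ D, d.1 < 0 → 0 < e.1 → e.1 * d.2 - d.1 * e.2 ≤ σ * (e.1 - d.1))
    (hneg : ∃ d ∈ D, d.1 < 0) (hpos : ∃ d ∈ D, 0 < d.1) :
    ∃ θ : ℝ, ∀ d ∈ D, d.2 + θ * d.1 ≤ σ := by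
  obtain ⟨d₀, hd₀, hd₀'⟩ := hneg
  obtain ⟨e₀, he₀, he₀'⟩ := hpos
  obtain ⟨θ, h1, h2⟩ := exists_between_of_forall_le
    (s := (fun d : ℝ × ℝ => (σ - d.2) / d.1) '' {d ∈ D | d.1 < 0})
    (t := (fun d : ℝ × ℝ => (σ - d.2) / d.1) '' {d ∈ D | 0 < d.1})
    ⟨_, d₀, ⟨hd₀, hd₀'⟩, rfl⟩ ⟨_, e₀, ⟨he₀, he₀'⟩, rfl⟩ (by
      rintro _ ⟨d, ⟨hd, hd'⟩, rfl⟩ _ ⟨e, ⟨he, he'⟩, rfl⟩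
      have := hcross d hd e he hd' he'
      simp only
      rw [div_le_iff_of_neg hd', div_mul_eq_mul_div, div_le_iff₀ he']
      linarith)
  refine ⟨θ, fun d hd => ?_⟩
  rcases lt_trichotomy d.1 0 with h | h | h
  · have : (σ - d.2) / d.1 ≤ θ := h1 ⟨d, ⟨hd, h⟩, rfl⟩
    rw [div_le_iff_of_neg h] at this
    linarith
  · rw [h, mul_zero, add_zero]
    exact hzero d hd h
  · have : θ ≤ (σ - d.2) / d.1 := h2 ⟨d, ⟨hd, h⟩, rfl⟩
    rw [le_div_iff₀ h] at this
    linarith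

section Standing

variable {Ω : Type*} [MeasurableSpace Ω] {μ : Measure Ω}
  {β : Ω → ℝ → EReal} {β' : Ω → ℝ → ℝ} {X : Ω → ℝ} {p₀ : Ω → ℝ} {b₀ : ℝ}

lemma Standing.coe_toReal (hst : Standing μ β β' X p₀ b₀) {r : Ω} {s : ℝ} (h : β r s ≠ ⊤) :
    ((β r s).toReal : EReal) = β r s :=
  EReal.coe_toReal h (hst.betaNeBot r s)

lemma Standing.tendsto_right (hst : Standing μ β β' X p₀ b₀) (r : Ω) {s : ℝ} (hs : 0 ≤ s) :
    Tendsto (β r) (𝓝[>] s) (𝓝 (β r s)) := by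
  rcases hs.eq_or_lt with rfl | hs
  · exact hst.betaZero r
  · have h1 : Tendsto (fun t => ((β r t).toReal : EReal)) (𝓝[>] s)
        (𝓝 ((β r s).toReal : EReal)) :=
      (continuous_coe_real_ereal.tendsto _).comp
        ((hst.betaDeriv r s hs).continuousAt.tendsto.mono_left nhdsWithin_le_nhds)
    rw [hst.coe_toReal (hst.betaFin r s hs)] at h1
    refine h1.congr' ?_
    filter_upwards [self_mem_nhdsWithin] with t ht
    exact hst.coe_toReal (hst.betaFin r t (hs.trans ht))

lemma Standing.tendsto_toReal_right (hst : Standing μ β β' X p₀ b₀) (r : Ω) {s : ℝ} (hs : 0 ≤ s)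
    (h : β r s ≠ ⊤) :
    Tendsto (fun ε => (β r (s + ε)).toReal) (𝓝[>] (0 : ℝ)) (𝓝 (β r s).toReal) := by
  refine (EReal.tendsto_toReal h (hst.betaNeBot r s)).comp ((hst.tendsto_right r hs).comp ?_)
  refine tendsto_nhdsWithin_iff.2 ⟨?_, ?_⟩
  · have : Tendsto (fun ε : ℝ => s + ε) (𝓝 0) (𝓝 (s + 0)) :=
      (continuous_const.add continuous_id).tendsto 0
    rw [add_zero] at this
    exact this.mono_left nhdsWithin_le_nhds
  · filter_upwards [self_mem_nhdsWithin] with ε hε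
    simpa using hε

lemma Standing.convex_ne_top (hst : Standing μ β β' X p₀ b₀) (r : Ω) {s s' a a' : ℝ}
    (hs : 0 ≤ s) (hs' : 0 ≤ s') (h : β r s ≠ ⊤) (ha : 0 < a) (ha' : 0 < a') :
    β r (a * s + a' * s') ≠ ⊤ := by
  rcases hs.eq_or_lt with rfl | hs
  · rcases hs'.eq_or_lt with rfl | hs'
    · simpa using h
    · exact hst.betaFin r _ (by positivity)
  · exact hst.betaFin r _ (by positivity)

lemma Standing.convex_toReal (hst : Standing μ β β' X p₀ b₀) (r : Ω) {s s' a a' : ℝ}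
    (hs : 0 ≤ s) (hs' : 0 ≤ s') (h : β r s ≠ ⊤) (h' : β r s' ≠ ⊤) (ha : 0 < a) (ha' : 0 < a')
    (haa' : a + a' = 1) :
    (β r (a * s + a' * s')).toReal ≤ a * (β r s).toReal + a' * (β r s').toReal := by
  refine le_of_tendsto_of_tendsto
    (hst.tendsto_toReal_right r (by positivity) (hst.convex_ne_top r hs hs' h ha ha'))
    (((hst.tendsto_toReal_right r hs h).const_mul a).add
      ((hst.tendsto_toReal_right r hs' h').const_mul a')) ?_
  filter_upwards [self_mem_nhdsWithin] with ε (hε : 0 < ε)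
  have := (hst.betaConv r).convexOn.2 (x := s + ε) (y := s' + ε)
    (show 0 < s + ε by positivity) (show 0 < s' + ε by positivity) ha.le ha'.le haa'
  simp only [smul_eq_mul] at this
  convert this using 3
  linear_combination (-ε) * haa'

/-- The integrand is jointly measurable enough to be composed with measurable functions. -/
lemma Standing.measurable_comp (hst : Standing μ β β' X p₀ b₀) {p : Ω → ℝ} (hp : Measurable p)
    (hp0 : ∀ r, 0 ≤ p r) : Measurable fun r => β r (p r) := by
  let g : ℕ → Ω → ℝ := fun n r => ((⌊((n : ℝ) + 1) * p r⌋₊ : ℝ) + 1) / ((n : ℝ) + 1)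
  refine measurable_of_tendsto_metrizable (f := fun n r => β r (g n r)) (fun n => ?_)
    (tendsto_pi_nhds.2 fun r => (hst.tendsto_right r (hp0 r)).comp ?_)
  · have h1 : Measurable fun x : Ω × ℕ => β x.1 (((x.2 : ℝ) + 1) / ((n : ℝ) + 1)) :=
      measurable_from_prod_countable_left fun k => hst.betaMeas (((k : ℝ) + 1) / ((n : ℝ) + 1))
    have h2 : Measurable fun r => (r, ⌊((n : ℝ) + 1) * p r⌋₊) :=
      measurable_id.prodMk (Nat.measurable_floor.comp (hp.const_mul _))
    exact h1.comp h2
  · have hlt : ∀ n, p r < g n r := fun n => by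
      have hn : (0 : ℝ) < n + 1 := by positivity
      rw [lt_div_iff₀ hn, mul_comm]
      exact Nat.lt_floor_add_one _
    have hle : ∀ n : ℕ, g n r ≤ p r + 1 / ((n : ℝ) + 1) := fun n => by
      have hn : (0 : ℝ) < n + 1 := by positivity
      have := Nat.floor_le (mul_nonneg hn.le (hp0 r))
      rw [div_le_iff₀ hn, add_mul (p r), div_mul_cancel₀ _ hn.ne']
      linarith
    refine tendsto_nhdsWithin_iff.2 ⟨?_, Eventually.of_forall hlt⟩
    refine tendsto_of_tendsto_of_tendsto_of_le_of_le tendsto_const_nhds ?_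
      (fun n => (hlt n).le) hle
    simpa using (tendsto_one_div_add_atTop_nhds_zero_nat (𝕜 := ℝ)).const_add (p r)

/-- Nonnegative functions along which all the integrals in the duality are finite. -/
structure Admissible (μ : Measure Ω) (β : Ω → ℝ → EReal) (X p : Ω → ℝ) : Prop where
  meas : Measurable p
  nonneg : ∀ r, 0 ≤ p r
  fin : ∀ r, β r (p r) ≠ ⊤
  int : Integrable p μ
  intX : Integrable (fun r => X r * p r) μ
  intβ : Integrable (fun r => (β r (p r)).toReal) μ

lemma Admissible.hfun_eq (hst : Standing μ β β' X p₀ b₀) {p : Ω → ℝ}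
    (hp : Admissible μ β X p) : Hfun μ β p = ((∫ r, (β r (p r)).toReal ∂μ : ℝ) : EReal) := by
  rw [← eInt_coe hp.intβ, Hfun]
  simp only [hst.coe_toReal (hp.fin _)]

lemma Admissible.xInt_eq {p : Ω → ℝ} (hp : Admissible μ β X p) :
    xInt μ X p = ((∫ r, X r * p r ∂μ : ℝ) : EReal) :=
  eInt_coe hp.intX

lemma Admissible.isDensity {p : Ω → ℝ} (hp : Admissible μ β X p) (h : ∫ r, p r ∂μ = 1) :
    IsDensity μ p := by
  refine ⟨hp.meas, hp.nonneg, ?_⟩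
  rw [← ofReal_integral_eq_lintegral_ofReal hp.int (ae_of_all _ hp.nonneg), h, ENNReal.ofReal_one]

lemma IsDensity.integrable {p : Ω → ℝ} (hp : IsDensity μ p) : Integrable p μ := by
  refine integrable_of_lintegral_ofReal_ne_top hp.1 (by simp [hp.2.2]) ?_
  simp [ENNReal.ofReal_of_nonpos, hp.2.1]

lemma IsDensity.integral_eq {p : Ω → ℝ} (hp : IsDensity μ p) : ∫ r, p r ∂μ = 1 := by
  rw [integral_eq_lintegral_of_nonneg_ae (ae_of_all _ hp.2.1) hp.1.aestronglyMeasurable, hp.2.2,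
    ENNReal.toReal_one]

lemma Standing.exists_admissible (hst : Standing μ β β' X p₀ b₀) {p : Ω → ℝ} {b : ℝ}
    (hp : IsDensity μ p) (hb : xInt μ X p = b) (hH : Hfun μ β p ≠ ⊤) :
    ∃ q, Admissible μ β X q ∧ q =ᵐ[μ] p := by
  classical
  have hm := hst.measurable_comp hp.1 hp.2.1
  have hbot : Hfun μ β p ≠ ⊥ := fun h => by simpa [h] using hst.Hnonneg p hp
  have hN : MeasurableSet {r | β r (p r) = ⊤} := hm (measurableSet_singleton ⊤)
  have hae : ∀ᵐ r ∂μ, β r (p r) ≠ ⊤ := by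
    filter_upwards [ae_lt_top hm.ereal_toENNReal (lintegral_pos_ne_top_of_eInt hbot hH)] with r hr h
    simp [h] at hr
  let q : Ω → ℝ := {r | β r (p r) = ⊤}.piecewise (fun _ => 1) p
  have hq : q =ᵐ[μ] p := by
    filter_upwards [hae] with r hr
    exact Set.piecewise_eq_of_notMem _ _ _ hr
  have hqm : Measurable q := Measurable.piecewise hN measurable_const hp.1
  have hcases : ∀ r, (β r (p r) = ⊤ ∧ q r = 1) ∨ (β r (p r) ≠ ⊤ ∧ q r = p r) := fun r => by
    by_cases h : β r (p r) = ⊤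
    · exact Or.inl ⟨h, Set.piecewise_eq_of_mem _ _ _ h⟩
    · exact Or.inr ⟨h, Set.piecewise_eq_of_notMem _ _ _ h⟩
  have hq0 : ∀ r, 0 ≤ q r := fun r => by
    rcases hcases r with ⟨_, h⟩ | ⟨_, h⟩
    · rw [h]; exact zero_le_one
    · rw [h]; exact hp.2.1 r
  have hqf : ∀ r, β r (q r) ≠ ⊤ := fun r => by
    rcases hcases r with ⟨_, h⟩ | ⟨h', h⟩
    · rw [h]; exact hst.betaFin r 1 one_pos
    · rwa [h]
  have hXp : Integrable (fun r => X r * p r) μ :=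
    integrable_of_eInt (hst.Xmeas.mul hp.1) (hb.trans_ne (EReal.coe_ne_bot b))
      (hb.trans_ne (EReal.coe_ne_top b))
  have hHq : eInt μ (fun r => ((β r (q r)).toReal : EReal)) = Hfun μ β p :=
    eInt_congr_ae (hq.mono fun r hr => by simp only [hst.coe_toReal (hqf r)]; rw [hr])
  refine ⟨q, ⟨hqm, hq0, hqf, hp.integrable.congr hq.symm,
    hXp.congr (hq.symm.mono fun r hr => by simp only [hr]),
    integrable_of_eInt (hst.measurable_comp hqm hq0).ereal_toReal (hHq ▸ hbot) (hHq ▸ hH)⟩, hq⟩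

lemma Admissible.piecewise (hst : Standing μ β β' X p₀ b₀) {p : Ω → ℝ}
    (hp : Admissible μ β X p) {B : Set Ω} [∀ r, Decidable (r ∈ B)]
    (hB : MeasurableSet B) (hBfin : μ B ≠ ⊤) {c k : ℝ}
    (hc : 0 < c) (hX : ∀ r ∈ B, |X r| ≤ k) (hβ : ∀ r ∈ B, |(β r c).toReal| ≤ k) :
    Admissible μ β X (B.piecewise (fun _ => c) p) := by
  have hbdd : ∀ {f : Ω → ℝ} (M : ℝ), Measurable f → (∀ r ∈ B, |f r| ≤ M) → IntegrableOn f B μ :=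
    fun {f} M hf h => Measure.integrableOn_of_bounded (M := M) hBfin hf.aestronglyMeasurable
      ((ae_restrict_iff' hB).2 (ae_of_all _ h))
  refine ⟨Measurable.piecewise hB measurable_const hp.meas, fun r => ?_, fun r => ?_, ?_, ?_, ?_⟩
  · by_cases h : r ∈ B <;> simp [h, hc.le, hp.nonneg r]
  · by_cases h : r ∈ B
    · simpa [h] using hst.betaFin r c hc
    · simpa [h] using hp.fin r
  · exact Integrable.piecewise hB (hbdd |c| measurable_const fun _ _ => le_rfl) hp.int.integrableOn
  · refine (Integrable.piecewise hB (hbdd (f := fun r => X r * c) (k * |c|) (hst.Xmeas.mul_const c)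
      fun r hr => ?_) hp.intX.integrableOn).congr (ae_of_all _ fun r => ?_)
    · rw [abs_mul]
      exact mul_le_mul_of_nonneg_right (hX r hr) (abs_nonneg c)
    · by_cases h : r ∈ B <;> simp [h]
  · refine (Integrable.piecewise hB (hbdd (f := fun r => (β r c).toReal) k
      (hst.betaMeas c).ereal_toReal hβ) hp.intβ.integrableOn).congr (ae_of_all _ fun r => ?_)
    by_cases h : r ∈ B <;> simp [h]

/-- Sets of finite measure on which `X` and `β(·, c)` are bounded. -/
def boundedCell (μ : Measure Ω) [SigmaFinite μ] (β : Ω → ℝ → EReal) (X : Ω → ℝ) (c : ℝ) (k : ℕ) :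
    Set Ω :=
  {r ∈ spanningSets μ k | |X r| ≤ k ∧ |(β r c).toReal| ≤ k}

lemma Standing.measurableSet_boundedCell [SigmaFinite μ] (hst : Standing μ β β' X p₀ b₀) (c : ℝ)
    (k : ℕ) : MeasurableSet (boundedCell μ β X c k) :=
  (measurableSet_spanningSets μ k).inter
    ((measurableSet_le (continuous_abs.measurable.comp hst.Xmeas) measurable_const).inter
      (measurableSet_le (continuous_abs.measurable.comp (hst.betaMeas c).ereal_toReal)
        measurable_const))

lemma measure_boundedCell_ne_top [SigmaFinite μ] {c : ℝ} {k : ℕ} {B : Set Ω}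
    (hB : B ⊆ boundedCell μ β X c k) : μ B ≠ ⊤ :=
  ne_top_of_le_ne_top (measure_spanningSets_lt_top μ k).ne
    (measure_mono (hB.trans (sep_subset _ _)))

lemma exists_mem_boundedCell [SigmaFinite μ] (r : Ω) (c : ℝ) :
    ∃ k, r ∈ boundedCell μ β X c k := by
  obtain ⟨i, hi⟩ := mem_iUnion.1 ((iUnion_spanningSets μ).symm ▸ mem_univ r)
  obtain ⟨j, hj⟩ := exists_nat_ge |X r|
  obtain ⟨l, hl⟩ := exists_nat_ge |(β r c).toReal|
  refine ⟨max i (max j l), monotone_spanningSets μ (le_max_left _ _) hi,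
    hj.trans (Nat.cast_le.2 ?_), hl.trans (Nat.cast_le.2 ?_)⟩ <;> simp

lemma Admissible.piecewise_boundedCell [SigmaFinite μ] (hst : Standing μ β β' X p₀ b₀) {p : Ω → ℝ}
    (hp : Admissible μ β X p) {B : Set Ω} [∀ r, Decidable (r ∈ B)]
    (hB : MeasurableSet B) {c : ℝ} {k : ℕ} (hc : 0 < c)
    (hsub : B ⊆ boundedCell μ β X c k) :
    Admissible μ β X (B.piecewise (fun _ => c) p) :=
  hp.piecewise hst hB (measure_boundedCell_ne_top hsub) hc (fun _ hr => (hsub hr).2.1)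
    (fun _ hr => (hsub hr).2.2)

lemma exists_pos_measure_inter_boundedCell [SigmaFinite μ] {E : ℚ → Set Ω}
    (hE : μ (⋃ q : {q : ℚ // 0 < q}, E q) ≠ 0) :
    ∃ (q : ℚ) (k : ℕ), 0 < q ∧ 0 < μ (boundedCell μ β X q k ∩ E q) := by
  by_contra! h
  refine hE (measure_mono_null (t := ⋃ q : {q : ℚ // 0 < q}, ⋃ k : ℕ,
    boundedCell μ β X (q : ℚ) k ∩ E q) ?_ ?_)
  · refine iUnion_mono fun q r hr => ?_
    obtain ⟨k, hk⟩ := exists_mem_boundedCell (μ := μ) (β := β) (X := X) r ((q : ℚ) : ℝ)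
    exact mem_iUnion.2 ⟨k, hk, hr⟩
  · exact measure_iUnion_null fun q => measure_iUnion_null fun k =>
      nonpos_iff_eq_zero.1 (h q k q.2)

lemma integral_piecewise_sub {p : Ω → ℝ} (hp : Integrable p μ) {B : Set Ω} [∀ r, Decidable (r ∈ B)]
    (hB : MeasurableSet B)
    (hBfin : μ B ≠ ⊤) (c : ℝ) :
    ∫ r, B.piecewise (fun _ => c) p r ∂μ - ∫ r, p r ∂μ = ∫ r in B, (c - p r) ∂μ := by
  have hc : IntegrableOn (fun _ : Ω => c) B μ := integrableOn_const hBfin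
  rw [integral_piecewise hB hc hp.integrableOn, ← integral_add_compl hB hp,
    integral_sub hc hp.integrableOn]
  ring

lemma Standing.exists_admissible_lt (hst : Standing μ β β' X p₀ b₀) {p : Ω → ℝ}
    (hp : Admissible μ β X p) (h1 : ∫ r, p r ∂μ = 1) :
    ∃ q, Admissible μ β X q ∧ ∫ r, q r ∂μ < 1 := by
  classical
  have := hst.sigma
  have hE : μ (⋃ q : {q : ℚ // 0 < q}, {r | (q : ℝ) < p r}) ≠ 0 := fun h0 => by
    have : ∀ᵐ r ∂μ, p r = 0 := by
      refine measure_mono_null (fun r (hr : p r ≠ 0) => ?_) h0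
      obtain ⟨q, hq, hq'⟩ := exists_rat_btwn ((hp.nonneg r).lt_of_ne' hr)
      exact mem_iUnion.2 ⟨⟨q, by exact_mod_cast hq⟩, hq'⟩
    rw [integral_congr_ae this] at h1
    simp at h1
  obtain ⟨q, k, hq, hpos⟩ := exists_pos_measure_inter_boundedCell (β := β) (X := X)
    (E := fun q => {r | (q : ℝ) < p r}) hE
  have hq' : (0 : ℝ) < q := by exact_mod_cast hq
  set B := boundedCell μ β X q k ∩ {r | (q : ℝ) < p r}
  have hB : MeasurableSet B := (hst.measurableSet_boundedCell q k).inter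
    (measurableSet_lt measurable_const hp.meas)
  have hsub : B ⊆ boundedCell μ β X q k := inter_subset_left
  have hfin := measure_boundedCell_ne_top hsub
  refine ⟨_, hp.piecewise_boundedCell hst hB hq' hsub, ?_⟩
  have hint := integral_piecewise_sub hp.int hB hfin q
  have hlt : 0 < ∫ r in B, (p r - q) ∂μ := by
    refine (setIntegral_pos_iff_support_of_nonneg_ae ?_ ?_).2 ?_
    · exact (ae_restrict_iff' hB).2 (ae_of_all _ fun r hr => (sub_pos.2 hr.2).le)
    · exact hp.int.integrableOn.sub (integrableOn_const hfin)
    · refine hpos.trans_le (measure_mono fun r hr => ⟨(sub_pos.2 hr.2).ne', hr⟩)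
  have hneg : ∫ r in B, ((q : ℝ) - p r) ∂μ = - ∫ r in B, (p r - q) ∂μ := by
    rw [← integral_neg]; simp
  linarith

lemma Standing.exists_admissible_gt (hst : Standing μ β β' X p₀ b₀) {p : Ω → ℝ}
    (hp : Admissible μ β X p) (h1 : ∫ r, p r ∂μ = 1) :
    ∃ q, Admissible μ β X q ∧ 1 < ∫ r, q r ∂μ := by
  classical
  have := hst.sigma
  have hE : μ (⋃ q : {q : ℚ // 0 < q}, {r | p r < (q : ℝ)}) ≠ 0 := fun h0 => by
    have huniv : μ univ = 0 := by
      refine measure_mono_null (fun r _ => ?_) h0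
      obtain ⟨q, hq, -⟩ := exists_rat_btwn (lt_add_one (p r))
      exact mem_iUnion.2 ⟨⟨q, by exact_mod_cast (hp.nonneg r).trans_lt hq⟩, hq⟩
    rw [Measure.measure_univ_eq_zero.1 huniv] at h1
    simp at h1
  obtain ⟨q, k, hq, hpos⟩ := exists_pos_measure_inter_boundedCell (β := β) (X := X)
    (E := fun q => {r | p r < (q : ℝ)}) hE
  have hq' : (0 : ℝ) < q := by exact_mod_cast hq
  set B := boundedCell μ β X q k ∩ {r | p r < (q : ℝ)}
  have hB : MeasurableSet B := (hst.measurableSet_boundedCell q k).inter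
    (measurableSet_lt hp.meas measurable_const)
  have hsub : B ⊆ boundedCell μ β X q k := inter_subset_left
  have hfin := measure_boundedCell_ne_top hsub
  refine ⟨_, hp.piecewise_boundedCell hst hB hq' hsub, ?_⟩
  have hint := integral_piecewise_sub hp.int hB hfin q
  have hlt : 0 < ∫ r in B, (q - p r) ∂μ := by
    refine (setIntegral_pos_iff_support_of_nonneg_ae ?_ ?_).2 ?_
    · exact (ae_restrict_iff' hB).2 (ae_of_all _ fun r hr => (sub_pos.2 hr.2).le)
    · exact (integrableOn_const hfin).sub hp.int.integrableOn
    · refine hpos.trans_le (measure_mono fun r hr => ⟨(sub_pos.2 hr.2).ne', hr⟩)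
  linarith

/-- A convex combination of admissible functions with total mass one is admissible: the lower
integrability of `β` along it comes from `0 ≤ H`. -/
lemma Admissible.convex (hst : Standing μ β β' X p₀ b₀) {p q : Ω → ℝ} (hp : Admissible μ β X p)
    (hq : Admissible μ β X q) {a a' : ℝ} (ha : 0 < a) (ha' : 0 < a') (haa' : a + a' = 1)
    (hmass : a * ∫ r, p r ∂μ + a' * ∫ r, q r ∂μ = 1) :
    Admissible μ β X (fun r => a * p r + a' * q r) ∧
      ∫ r, (β r (a * p r + a' * q r)).toReal ∂μ ≤
        a * ∫ r, (β r (p r)).toReal ∂μ + a' * ∫ r, (β r (q r)).toReal ∂μ := by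
  have hm : Measurable fun r => a * p r + a' * q r :=
    (hp.meas.const_mul a).add (hq.meas.const_mul a')
  have h0 : ∀ r, 0 ≤ a * p r + a' * q r := fun r =>
    add_nonneg (mul_nonneg ha.le (hp.nonneg r)) (mul_nonneg ha'.le (hq.nonneg r))
  have hf : ∀ r, β r (a * p r + a' * q r) ≠ ⊤ := fun r =>
    hst.convex_ne_top r (hp.nonneg r) (hq.nonneg r) (hp.fin r) ha ha'
  have hint : Integrable (fun r => a * p r + a' * q r) μ :=
    (hp.int.const_mul a).add (hq.int.const_mul a')
  have hle : ∀ r, (β r (a * p r + a' * q r)).toReal ≤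
      a * (β r (p r)).toReal + a' * (β r (q r)).toReal := fun r =>
    hst.convex_toReal r (hp.nonneg r) (hq.nonneg r) (hp.fin r) (hq.fin r) ha ha' haa'
  have hub : Integrable (fun r => a * (β r (p r)).toReal + a' * (β r (q r)).toReal) μ :=
    (hp.intβ.const_mul a).add (hq.intβ.const_mul a')
  have hdens : IsDensity μ fun r => a * p r + a' * q r := by
    refine ⟨hm, h0, ?_⟩
    rw [← ofReal_integral_eq_lintegral_ofReal hint (ae_of_all _ h0),
      integral_add (hp.int.const_mul a) (hq.int.const_mul a'), integral_const_mul,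
      integral_const_mul, hmass, ENNReal.ofReal_one]
  have hH := hst.Hnonneg _ hdens
  have hβ : Integrable (fun r => (β r (a * p r + a' * q r)).toReal) μ := by
    have heq : eInt μ (fun r => ((β r (a * p r + a' * q r)).toReal : EReal)) =
        Hfun μ β (fun r => a * p r + a' * q r) := by
      simp only [Hfun, hst.coe_toReal (hf _)]
    refine integrable_of_eInt (hst.measurable_comp hm h0).ereal_toReal ?_ ?_
    · rw [heq]; exact (EReal.bot_lt_zero.trans_le hH).ne'
    · refine ne_top_of_le_ne_top (EReal.coe_ne_top _)
        ((eInt_mono fun r => EReal.coe_le_coe_iff.2 (hle r)).trans (eInt_coe hub).le)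
  refine ⟨⟨hm, h0, hf, hint, ?_, hβ⟩, ?_⟩
  · refine ((hp.intX.const_mul a).add (hq.intX.const_mul a')).congr (ae_of_all _ fun r => ?_)
    simp only [Pi.add_apply]
    ring
  · refine (integral_mono hβ hub hle).trans_eq ?_
    rw [integral_add (hp.intβ.const_mul a) (hq.intβ.const_mul a'), integral_const_mul,
      integral_const_mul]

lemma Standing.conj_le (hst : Standing μ β β' X p₀ b₀) {r : Ω} {τ : ℝ} {y : EReal}
    (hy : ∀ q : ℚ, 0 < q → (((q : ℝ) * τ - (β r q).toReal : ℝ) : EReal) ≤ y) :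
    conjβ β r τ ≤ y := by
  refine iSup_le fun s => ?_
  rcases lt_or_ge s 0 with hs | hs
  · rw [hst.betaNeg r s hs, EReal.sub_top]
    exact bot_le
  have h1 : Tendsto (fun t : ℝ => ((t * τ : ℝ) : EReal)) (𝓝[>] s) (𝓝 ((s * τ : ℝ) : EReal)) :=
    ((continuous_coe_real_ereal.comp (continuous_id.mul continuous_const)).tendsto s).mono_left
      nhdsWithin_le_nhds
  have h2 := (continuous_neg.tendsto _).comp (hst.tendsto_right r hs)
  have h3 := (EReal.continuousAt_add (p := (_, _)) (Or.inl (EReal.coe_ne_top _))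
    (Or.inl (EReal.coe_ne_bot _))).tendsto.comp (h1.prodMk_nhds h2)
  rw [sub_eq_add_neg]
  refine isClosed_Iic.mem_of_frequently_of_tendsto ?_ h3
  refine fun hev => ?_
  obtain ⟨u, hu, hsub⟩ := mem_nhdsGT_iff_exists_Ioo_subset.1 hev
  obtain ⟨q, hq, hq'⟩ := exists_rat_btwn (show s < u from hu)
  refine hsub ⟨hq, hq'⟩ ?_
  have hq0 : (0 : ℝ) < q := hs.trans_lt hq
  have := hy q (by exact_mod_cast hq0)
  rwa [EReal.coe_sub, hst.coe_toReal (hst.betaFin r q hq0), sub_eq_add_neg] at this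

lemma Standing.le_conj (hst : Standing μ β β' X p₀ b₀) {p : Ω → ℝ} (hp : Admissible μ β X p)
    (r : Ω) (τ : ℝ) : ((p r * τ - (β r (p r)).toReal : ℝ) : EReal) ≤ conjβ β r τ := by
  rw [EReal.coe_sub, hst.coe_toReal (hp.fin r)]
  exact le_iSup (fun s : ℝ => (((s * τ : ℝ) : EReal) - β r s)) (p r)

lemma Admissible.integrable_val {p : Ω → ℝ} (hp : Admissible μ β X p) (θ₁ θ₂ : ℝ) :
    Integrable (fun r => p r * (θ₁ + θ₂ * X r) - (β r (p r)).toReal) μ ∧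
    ∫ r, (p r * (θ₁ + θ₂ * X r) - (β r (p r)).toReal) ∂μ =
      θ₁ * ∫ r, p r ∂μ + θ₂ * ∫ r, X r * p r ∂μ - ∫ r, (β r (p r)).toReal ∂μ := by
  have h1 := hp.int.const_mul θ₁
  have h2 := hp.intX.const_mul θ₂
  have heq : (fun r => p r * (θ₁ + θ₂ * X r) - (β r (p r)).toReal) =
      fun r => (θ₁ * p r + θ₂ * (X r * p r)) - (β r (p r)).toReal := by
    funext r; ring
  rw [heq]
  refine ⟨(h1.add h2).sub hp.intβ, ?_⟩
  rw [integral_sub (f := fun r => θ₁ * p r + θ₂ * (X r * p r)) (h1.add h2) hp.intβ,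
    integral_add h1 h2, integral_const_mul, integral_const_mul]

lemma Standing.val_le_Kfun (hst : Standing μ β β' X p₀ b₀) {p : Ω → ℝ} (hp : Admissible μ β X p)
    (θ₁ θ₂ : ℝ) :
    ((θ₁ * ∫ r, p r ∂μ + θ₂ * ∫ r, X r * p r ∂μ - ∫ r, (β r (p r)).toReal ∂μ : ℝ) : EReal) ≤
      Kfun μ β X θ₁ θ₂ := by
  rw [← (hp.integrable_val θ₁ θ₂).2, ← eInt_coe (hp.integrable_val θ₁ θ₂).1]
  exact eInt_mono fun r => hst.le_conj hp r _

/-- Interchange of supremum and integral: `K` is the supremum of the values along admissible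
functions. -/
lemma Standing.Kfun_le (hst : Standing μ β β' X p₀ b₀) (hne : ∃ p, Admissible μ β X p)
    {θ₁ θ₂ C : ℝ}
    (hC : ∀ p, Admissible μ β X p →
      ∫ r, (p r * (θ₁ + θ₂ * X r) - (β r (p r)).toReal) ∂μ ≤ C) :
    Kfun μ β X θ₁ θ₂ ≤ C := by
  classical
  have := hst.sigma
  let val : (Ω → ℝ) → Ω → ℝ := fun p r => p r * (θ₁ + θ₂ * X r) - (β r (p r)).toReal
  have hval : ∀ {p q : Ω → ℝ} {r : Ω}, p r = q r → val p r = val q r := fun h => by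
    simp only [val, h]
  have : Nonempty {q : ℚ // 0 < q} := ⟨⟨1, one_pos⟩⟩
  obtain ⟨e, he⟩ := exists_surjective_nat ({q : ℚ // 0 < q} × ℕ)
  have step : ∀ (n : ℕ) (p : {p // Admissible μ β X p}), ∃ p' : {p // Admissible μ β X p},
      (∀ r, val p.1 r ≤ val p'.1 r) ∧ ∀ r ∈ boundedCell μ β X (((e n).1 : ℚ) : ℝ) (e n).2,
        val (fun _ => (((e n).1 : ℚ) : ℝ)) r ≤ val p'.1 r := by
    rintro n ⟨p, hp⟩
    set q : ℝ := (((e n).1 : ℚ) : ℝ)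
    have hq : 0 < q := Rat.cast_pos.2 (e n).1.2
    have hvp : Measurable (val p) := (hp.meas.mul ((hst.Xmeas.const_mul θ₂).const_add θ₁)).sub
      (hst.measurable_comp hp.meas hp.nonneg).ereal_toReal
    have hvq : Measurable (val fun _ => q) :=
      (((hst.Xmeas.const_mul θ₂).const_add θ₁).const_mul q).sub (hst.betaMeas q).ereal_toReal
    set B := boundedCell μ β X q (e n).2 ∩ {r | val p r < val (fun _ => q) r}
    have hB : MeasurableSet B :=
      (hst.measurableSet_boundedCell q _).inter (measurableSet_lt hvp hvq)
    have hin : ∀ r ∈ B, val (B.piecewise (fun _ => q) p) r = val (fun _ => q) r := fun r hr =>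
      hval (Set.piecewise_eq_of_mem _ _ _ hr)
    have hout : ∀ r ∉ B, val (B.piecewise (fun _ => q) p) r = val p r := fun r hr =>
      hval (Set.piecewise_eq_of_notMem _ _ _ hr)
    refine ⟨⟨_, hp.piecewise_boundedCell hst hB hq inter_subset_left⟩, fun r => ?_, fun r hr => ?_⟩
    · by_cases h : r ∈ B
      · exact h.2.le.trans (hin r h).ge
      · exact (hout r h).ge
    · by_cases h : r ∈ B
      · exact (hin r h).ge
      · refine (not_lt.1 fun hlt => h ⟨hr, hlt⟩).trans (hout r h).ge
  choose next hnext hnext' using step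
  obtain ⟨p, hp⟩ := hne
  let P : ℕ → {p // Admissible μ β X p} := fun n => Nat.rec ⟨p, hp⟩ next n
  have hmono : ∀ r, Monotone fun n => val (P n).1 r := fun r =>
    monotone_nat_of_le_succ fun n => hnext n (P n) r
  have hconj : ∀ r, conjβ β r (θ₁ + θ₂ * X r) ≤ ⨆ n, (val (P n).1 r : EReal) := fun r => by
    refine hst.conj_le fun q hq => ?_
    obtain ⟨k, hk⟩ := exists_mem_boundedCell (μ := μ) (β := β) (X := X) r (q : ℝ)
    obtain ⟨n, hn⟩ := he (⟨q, hq⟩, k)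
    have h1 := hnext' n (P n) r (by rw [hn]; exact hk)
    rw [hn] at h1
    exact (EReal.coe_le_coe_iff.2 h1).trans (le_iSup (fun n => (val (P n).1 r : EReal)) (n + 1))
  exact (eInt_mono hconj).trans (eInt_iSup_le (fun n => ((P n).2.integrable_val θ₁ θ₂).1) hmono
    fun n => hC _ (P n).2)

lemma Standing.val_le_conj_Ffun (hst : Standing μ β β' X p₀ b₀) {p : Ω → ℝ}
    (hp : Admissible μ β X p) (h1 : ∫ r, p r ∂μ = 1) (θ₂ : ℝ) :
    ((θ₂ * ∫ r, X r * p r ∂μ - ∫ r, (β r (p r)).toReal ∂μ : ℝ) : EReal) ≤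
      ⨆ b : ℝ, (((θ₂ * b : ℝ) : EReal) - Ffun μ β X b) := by
  refine le_trans ?_ (le_iSup _ (∫ r, X r * p r ∂μ))
  rw [EReal.coe_sub, ← hp.hfun_eq hst]
  exact EReal.sub_le_sub le_rfl (iInf_le (fun q : {q : Ω → ℝ // IsDensity μ q ∧
    xInt μ X q = ((∫ r, X r * p r ∂μ : ℝ) : EReal)} => Hfun μ β q.1)
    ⟨p, hp.isDensity h1, hp.xInt_eq⟩)

lemma Standing.Ffun_nonneg (hst : Standing μ β β' X p₀ b₀) (b : ℝ) : 0 ≤ Ffun μ β X b :=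
  le_iInf fun p => hst.Hnonneg p.1 p.2.1

lemma Standing.exists_admissible_density (hst : Standing μ β β' X p₀ b₀) :
    ∃ p, Admissible μ β X p ∧ ∫ r, p r ∂μ = 1 := by
  obtain ⟨q, hq, hqp⟩ := hst.exists_admissible hst.dens₀ hst.payoff₀ (by simp [hst.H₀])
  exact ⟨q, hq, (integral_congr_ae hqp).trans hst.dens₀.integral_eq⟩

/-- Weak duality. -/
lemma Standing.conj_Ffun_le_Gfun (hst : Standing μ β β' X p₀ b₀) (θ₂ : ℝ) :
    (⨆ b : ℝ, (((θ₂ * b : ℝ) : EReal) - Ffun μ β X b)) ≤ Gfun μ β X θ₂ := by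
  refine iSup_le fun b => le_iInf fun θ₁ => ?_
  obtain ⟨p₁, hp₁, -⟩ := hst.exists_admissible_density
  have hKbot := ne_bot_of_le_ne_bot (EReal.coe_ne_bot _) (hst.val_le_Kfun hp₁ θ₁ θ₂)
  by_cases hKtop : Kfun μ β X θ₁ θ₂ = ⊤
  · rw [hKtop, EReal.top_sub_coe]
    exact le_top
  have hK : ((Kfun μ β X θ₁ θ₂).toReal : EReal) = Kfun μ β X θ₁ θ₂ :=
    EReal.coe_toReal hKtop hKbot
  rw [← hK, ← EReal.coe_sub]
  refine EReal.sub_le_of_le_add' (EReal.sub_le_iff_le_add (Or.inl (EReal.coe_ne_bot _))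
    (Or.inl (EReal.coe_ne_top _)) |>.1 ?_)
  rw [← EReal.coe_sub]
  refine le_iInf fun ⟨p, hp, hb⟩ => ?_
  by_cases hH : Hfun μ β p = ⊤
  · rw [hH]
    exact le_top
  obtain ⟨q, hq, hqp⟩ := hst.exists_admissible hp hb hH
  have h1 : ∫ r, q r ∂μ = 1 := (integral_congr_ae hqp).trans hp.integral_eq
  have h2 : ∫ r, X r * q r ∂μ = b := by
    rw [← EReal.coe_eq_coe_iff, ← hb, ← hq.xInt_eq]
    exact eInt_congr_ae (hqp.mono fun r hr => by simp only [hr])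
  have h3 : Hfun μ β p = ((∫ r, (β r (q r)).toReal ∂μ : ℝ) : EReal) := by
    rw [← hq.hfun_eq hst]
    exact eInt_congr_ae (hqp.mono fun r hr => by simp only [hr])
  have h4 := hst.val_le_Kfun hq θ₁ θ₂
  rw [← hK, EReal.coe_le_coe_iff, h1, h2] at h4
  simp only [h3]
  rw [EReal.coe_le_coe_iff]
  linarith

/-- Strong duality. -/
lemma Standing.Gfun_le_conj_Ffun (hst : Standing μ β β' X p₀ b₀) (θ₂ : ℝ) :
    Gfun μ β X θ₂ ≤ ⨆ b : ℝ, (((θ₂ * b : ℝ) : EReal) - Ffun μ β X b) := by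
  obtain ⟨p₁, hp₁, hp₁'⟩ := hst.exists_admissible_density
  have hle := fun {p} (hp : Admissible μ β X p) h1 => hst.val_le_conj_Ffun hp h1 θ₂
  set S := ⨆ b : ℝ, (((θ₂ * b : ℝ) : EReal) - Ffun μ β X b)
  by_cases hStop : S = ⊤
  · rw [hStop]
    exact le_top
  lift S to ℝ using ⟨hStop, ne_bot_of_le_ne_bot (EReal.coe_ne_bot _) (hle hp₁ hp₁')⟩ with σ
  let Ψ : (Ω → ℝ) → ℝ := fun p => θ₂ * ∫ r, X r * p r ∂μ - ∫ r, (β r (p r)).toReal ∂μ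
  let mass : (Ω → ℝ) → ℝ := fun p => ∫ r, p r ∂μ
  obtain ⟨θ₁, hθ₁⟩ := exists_multiplier
    ((fun p : Ω → ℝ => (mass p - 1, Ψ p)) '' {p | Admissible μ β X p}) σ
    (by
      rintro _ ⟨p, hp, rfl⟩ h
      exact EReal.coe_le_coe_iff.1 (hle hp (sub_eq_zero.1 h)))
    (by
      rintro _ ⟨p, hp, rfl⟩ _ ⟨q, hq, rfl⟩ h h'
      simp only at h h' ⊢
      have hd : 0 < mass q - mass p := by linarith
      have ha : 0 < (mass q - 1) / (mass q - mass p) := div_pos h' hd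
      have ha' : 0 < (1 - mass p) / (mass q - mass p) := div_pos (by linarith) hd
      have hsum : (mass q - 1) / (mass q - mass p) + (1 - mass p) / (mass q - mass p) = 1 := by
        field_simp; ring
      have hmass : (mass q - 1) / (mass q - mass p) * mass p +
          (1 - mass p) / (mass q - mass p) * mass q = 1 := by
        field_simp; ring
      obtain ⟨hu, huβ⟩ := Admissible.convex hst hp hq ha ha' hsum hmass
      have hu1 : ∫ r, ((mass q - 1) / (mass q - mass p) * p r +
          (1 - mass p) / (mass q - mass p) * q r) ∂μ = 1 := by
        rw [integral_add (hp.int.const_mul _) (hq.int.const_mul _), integral_const_mul,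
          integral_const_mul]
        exact hmass
      have huX : ∫ r, X r * ((mass q - 1) / (mass q - mass p) * p r +
          (1 - mass p) / (mass q - mass p) * q r) ∂μ =
          (mass q - 1) / (mass q - mass p) * ∫ r, X r * p r ∂μ +
          (1 - mass p) / (mass q - mass p) * ∫ r, X r * q r ∂μ := by
        rw [← integral_const_mul, ← integral_const_mul,
          ← integral_add (hp.intX.const_mul _) (hq.intX.const_mul _)]
        congr 1 with r
        ring
      have key := EReal.coe_le_coe_iff.1 (hle hu hu1)
      rw [huX] at key
      have key' : (mass q - 1) / (mass q - mass p) * Ψ p +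
          (1 - mass p) / (mass q - mass p) * Ψ q ≤ σ := by
        simp only [Ψ]
        linarith
      rw [div_mul_eq_mul_div, div_mul_eq_mul_div, ← add_div, div_le_iff₀ hd] at key'
      linarith)
    (by
      obtain ⟨q, hq, hq'⟩ := hst.exists_admissible_lt hp₁ hp₁'
      exact ⟨_, ⟨q, hq, rfl⟩, sub_neg.2 hq'⟩)
    (by
      obtain ⟨q, hq, hq'⟩ := hst.exists_admissible_gt hp₁ hp₁'
      exact ⟨_, ⟨q, hq, rfl⟩, sub_pos.2 hq'⟩)
  have hK : Kfun μ β X θ₁ θ₂ ≤ ((σ + θ₁ : ℝ) : EReal) := by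
    refine hst.Kfun_le ⟨p₁, hp₁⟩ fun p hp => ?_
    have : Ψ p + θ₁ * (mass p - 1) ≤ σ := hθ₁ _ ⟨p, hp, rfl⟩
    rw [(hp.integrable_val θ₁ θ₂).2]
    simp only [Ψ, mass] at this
    linarith
  exact (iInf_le _ θ₁).trans (EReal.sub_le_of_le_add (by rwa [← EReal.coe_add]))

end Standing

/-- `F* = G`. The convex conjugate of `F` equals `G`:
`sup_b (θ₂ b − F(b)) = G(θ₂)` for all `θ₂`. In particular `G` is a closed (lower
semicontinuous) convex function. -/
theorem Fstar_eq_G {Ω : Type*} [MeasurableSpace Ω] (μ : Measure Ω)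
    (β : Ω → ℝ → EReal) (β' : Ω → ℝ → ℝ) (X : Ω → ℝ) (p₀ : Ω → ℝ) (b₀ : ℝ)
    (hst : Standing μ β β' X p₀ b₀) :
    (∀ θ₂ : ℝ, (⨆ b : ℝ, (((θ₂ * b : ℝ) : EReal) - Ffun μ β X b)) = Gfun μ β X θ₂) ∧
    LowerSemicontinuous (Gfun μ β X) ∧
    (∀ θ₂ θ₂' : ℝ, ∀ t : ℝ, 0 ≤ t → t ≤ 1 →
      Gfun μ β X (t * θ₂ + (1 - t) * θ₂') ≤
        ((t : ℝ) : EReal) * Gfun μ β X θ₂ + (((1 - t : ℝ)) : EReal) * Gfun μ β X θ₂') := by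
  have hG : ∀ θ₂ : ℝ, (⨆ b : ℝ, (((θ₂ * b : ℝ) : EReal) - Ffun μ β X b)) = Gfun μ β X θ₂ :=
    fun θ₂ => (hst.conj_Ffun_le_Gfun θ₂).antisymm (hst.Gfun_le_conj_Ffun θ₂)
  refine ⟨hG, ?_, fun θ₂ θ₂' t ht0 ht1 => ?_⟩
  · rw [show Gfun μ β X = fun θ₂ => ⨆ b : ℝ, (((θ₂ * b : ℝ) : EReal) - Ffun μ β X b) from
      funext fun θ₂ => (hG θ₂).symm]
    refine lowerSemicontinuous_iSup fun b => Continuous.lowerSemicontinuous ?_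
    have hbot : Ffun μ β X b ≠ ⊥ := (EReal.bot_lt_zero.trans_le (hst.Ffun_nonneg b)).ne'
    by_cases htop : Ffun μ β X b = ⊤
    · simp only [htop, EReal.sub_top]
      exact continuous_const
    · rw [← EReal.coe_toReal htop hbot]
      simp only [← EReal.coe_sub]
      exact continuous_coe_real_ereal.comp (by fun_prop)
  · rw [← hG (t * θ₂ + (1 - t) * θ₂')]
    refine iSup_le fun b => ?_
    have hbot : Ffun μ β X b ≠ ⊥ := (EReal.bot_lt_zero.trans_le (hst.Ffun_nonneg b)).ne'
    by_cases htop : Ffun μ β X b = ⊤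
    · simp [htop, EReal.sub_top]
    have hle : ∀ θ : ℝ, ((θ * b - (Ffun μ β X b).toReal : ℝ) : EReal) ≤ Gfun μ β X θ := fun θ => by
      rw [← hG θ, EReal.coe_sub, EReal.coe_toReal htop hbot]
      exact le_iSup (fun b : ℝ => ((θ * b : ℝ) : EReal) - Ffun μ β X b) b
    calc (((t * θ₂ + (1 - t) * θ₂') * b : ℝ) : EReal) - Ffun μ β X b
        = (t : EReal) * ((θ₂ * b - (Ffun μ β X b).toReal : ℝ) : EReal) +
          ((1 - t : ℝ) : EReal) * ((θ₂' * b - (Ffun μ β X b).toReal : ℝ) : EReal) := by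
          rw [← EReal.coe_toReal htop hbot, ← EReal.coe_sub, ← EReal.coe_mul, ← EReal.coe_mul,
            ← EReal.coe_add, EReal.coe_eq_coe_iff, EReal.toReal_coe]
          ring
      _ ≤ _ := add_le_add
          (mul_le_mul_of_nonneg_left (hle θ₂) (EReal.coe_nonneg.2 ht0))
          (mul_le_mul_of_nonneg_left (hle θ₂') (EReal.coe_nonneg.2 (sub_nonneg.2 ht1)))
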